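/- Let $d\ge 1$ and $\alpha\in(0,\min(2,d))$. There exists a constant $C>0$, depending only on $d$ and $\alpha$, such that for all $0<t\le t'$: $\sup_{x\in Q}\int_0^{t} \|G_d(t'-s,x,\cdot)-G_d(t-s,x,\cdot)\|_{(\alpha)}^2\, ds \le C\, (t'-t)^{1-\alpha/2}$. -/

import Mathlib

open MeasureTheory

/-- `φ_j(ξ) = √2 sin(jπξ)`. -/
noncomputable def phiF (j : ℕ) (ξ : ℝ) : ℝ := Real.sqrt 2 * Real.sin ((j : ℝ) * Real.pi * ξ)

/-- Green function of the heat operator on `[0,1]` with homogeneous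
Dirichlet boundary conditions: `G(t,x,y) = ∑_{j≥1} e^{-j²π²t} φ_j(x) φ_j(y)`. -/
noncomputable def G (t x y : ℝ) : ℝ :=
  ∑' j : ℕ, Real.exp (-((j : ℝ) + 1) ^ 2 * Real.pi ^ 2 * t) * phiF (j + 1) x * phiF (j + 1) y

/-- The cube `Q = [0,1]^d`. -/
def Q (d : ℕ) : Set (EuclideanSpace ℝ (Fin d)) := {x | ∀ i, x i ∈ Set.Icc (0 : ℝ) 1}

/-- `G_d(t,x,y) = ∏_i G(t,x_i,y_i)` on `Q = [0,1]^d`. -/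
noncomputable def Gd (d : ℕ) (t : ℝ) (x y : EuclideanSpace ℝ (Fin d)) : ℝ :=
  ∏ i, G t (x i) (y i)

/-- `‖φ‖_{(α)}² = ∫_Q ∫_Q |φ(y)| |y-z|^{-α} |φ(z)| dy dz`. -/
noncomputable def normAlphaSq (d : ℕ) (α : ℝ) (f : EuclideanSpace ℝ (Fin d) → ℝ) : ℝ :=
  ∫ y in Q d, ∫ z in Q d, |f y| * ‖y - z‖ ^ (-α) * |f z|

/-- periodic heat kernel -/
noncomputable def Pk (t u : ℝ) : ℝ := HurwitzZeta.cosKernel ((u / 2 : ℝ) : UnitAddCircle) (Real.pi * t) / 2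

lemma Pk_hasSum {t : ℝ} (ht : 0 < t) (u : ℝ) :
    HasSum (fun n : ℕ => Real.exp (-((n : ℝ) + 1) ^ 2 * Real.pi ^ 2 * t) *
      Real.cos (((n : ℝ) + 1) * Real.pi * u)) (Pk t u - 1 / 2) := by
  have h := (HurwitzZeta.hasSum_nat_cosKernel₀ (u / 2) (mul_pos Real.pi_pos ht)).div_const 2
  have e : (HurwitzZeta.cosKernel ((u / 2 : ℝ) : UnitAddCircle) (Real.pi * t) - 1) / 2
      = Pk t u - 1 / 2 := by unfold Pk; ring
  rw [e] at h
  refine h.congr_fun fun n => ?_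
  have e1 : 2 * Real.pi * (u / 2) * ((n : ℝ) + 1) = ((n : ℝ) + 1) * Real.pi * u := by ring
  have e2 : -Real.pi * ((n : ℝ) + 1) ^ 2 * (Real.pi * t)
    = -((n : ℝ) + 1) ^ 2 * Real.pi ^ 2 * t := by ring
  rw [e1, e2]; ring

lemma summable_exp_sq {t : ℝ} (ht : 0 < t) :
    Summable (fun n : ℕ => Real.exp (-((n : ℝ) + 1) ^ 2 * Real.pi ^ 2 * t)) := by
  have := (Pk_hasSum ht 0).summable
  simpa using this

lemma G_eq {t : ℝ} (ht : 0 < t) (x y : ℝ) : G t x y = Pk t (x - y) - Pk t (x + y) := by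
  have h := (Pk_hasSum ht (x - y)).sub (Pk_hasSum ht (x + y))
  rw [sub_sub_sub_cancel_right] at h
  rw [← h.tsum_eq]
  unfold G phiF
  congr 1
  ext n
  have h2 : Real.sqrt 2 * Real.sqrt 2 = 2 := Real.mul_self_sqrt (by norm_num)
  push_cast
  rw [mul_sub (((n : ℝ) + 1) * Real.pi), mul_add (((n : ℝ) + 1) * Real.pi), Real.cos_sub, Real.cos_add]
  linear_combination (Real.exp (-((n : ℝ) + 1) ^ 2 * Real.pi ^ 2 * t)
    * Real.sin (((n : ℝ) + 1) * Real.pi * x) * Real.sin (((n : ℝ) + 1) * Real.pi * y)) * h2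

lemma Pk_hasSum' {t : ℝ} (ht : 0 < t) (u : ℝ) :
    HasSum (fun n : ℤ => (1 / (2 * Real.sqrt (Real.pi * t))) *
      Real.exp (-((n : ℝ) + u / 2) ^ 2 / t)) (Pk t u) := by
  have hp : 0 < Real.pi * t := mul_pos Real.pi_pos ht
  have h := (HurwitzZeta.hasSum_int_evenKernel (u / 2) (one_div_pos.2 hp)).mul_left
    (1 / (2 * Real.sqrt (Real.pi * t)))
  have e : (1 / (2 * Real.sqrt (Real.pi * t))) *
      HurwitzZeta.evenKernel ((u / 2 : ℝ) : UnitAddCircle) (1 / (Real.pi * t)) = Pk t u := by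
    rw [HurwitzZeta.evenKernel_functional_equation, one_div_one_div, ← Real.sqrt_eq_rpow, Pk,
      Real.sqrt_div zero_le_one, Real.sqrt_one, one_div_one_div]
    have : Real.sqrt (Real.pi * t) ≠ 0 := (Real.sqrt_pos.2 hp).ne'
    field_simp
  rw [e] at h
  refine h.congr_fun fun n => ?_
  congr 2
  have := Real.pi_pos.ne'
  field_simp

lemma Pk_nonneg {t : ℝ} (ht : 0 < t) (u : ℝ) : 0 ≤ Pk t u :=
  (Pk_hasSum' ht u).nonneg fun n => by positivity

lemma Pk_mono {t t' : ℝ} (ht : 0 < t) (htt : t ≤ t') (u : ℝ) :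
    t / t' * Pk t u ≤ Pk t' u := by
  have ht' : 0 < t' := ht.trans_le htt
  refine hasSum_le (fun n => ?_) ((Pk_hasSum' ht u).mul_left (t / t')) (Pk_hasSum' ht' u)
  rw [← mul_assoc]
  have hs := Real.sqrt_pos.2 (mul_pos Real.pi_pos ht)
  have hs' := Real.sqrt_pos.2 (mul_pos Real.pi_pos ht')
  have e1 := Real.mul_self_sqrt (mul_pos Real.pi_pos ht).le
  have e2 := Real.mul_self_sqrt (mul_pos Real.pi_pos ht').le
  have hle : Real.sqrt (Real.pi * t) ≤ Real.sqrt (Real.pi * t') :=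
    Real.sqrt_le_sqrt (by gcongr)
  apply mul_le_mul
  · have : t / t' = (Real.sqrt (Real.pi * t) / Real.sqrt (Real.pi * t')) ^ 2 := by
      rw [div_pow, Real.sq_sqrt (by positivity), Real.sq_sqrt (by positivity)]
      have := Real.pi_pos.ne'
      field_simp
    rw [this]
    have h1 : Real.sqrt (Real.pi * t) / Real.sqrt (Real.pi * t') ≤ 1 := (div_le_one hs').2 hle
    calc _ ≤ (Real.sqrt (Real.pi * t) / Real.sqrt (Real.pi * t')) ^ 1 *
          (1 / (2 * Real.sqrt (Real.pi * t))) := by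
          gcongr ?_ * _
          exact pow_le_pow_of_le_one (by positivity) h1 (by norm_num)
      _ = _ := by field_simp
  · apply Real.exp_le_exp.2
    rw [div_le_div_iff₀ ht ht']
    nlinarith [sq_nonneg ((n : ℝ) + u / 2)]
  · positivity
  · positivity

lemma Pk_continuous {t : ℝ} (ht : 0 < t) : Continuous (Pk t) := by
  have : Pk t = fun u => (∑' n : ℕ, Real.exp (-((n : ℝ) + 1) ^ 2 * Real.pi ^ 2 * t) *
      Real.cos (((n : ℝ) + 1) * Real.pi * u)) + 1 / 2 := by
    ext u
    rw [(Pk_hasSum ht u).tsum_eq]; ring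
  rw [this]
  refine Continuous.add (continuous_tsum (fun n => by fun_prop) (summable_exp_sq ht) fun n u => ?_)
    continuous_const
  rw [norm_mul, Real.norm_of_nonneg (Real.exp_pos _).le]
  exact mul_le_of_le_one_right (Real.exp_pos _).le (Real.abs_cos_le_one _)

lemma Pk_integral {t : ℝ} (ht : 0 < t) (a : ℝ) : ∫ u in a..(a + 2), Pk t u = 1 := by
  have h := intervalIntegral.hasSum_integral_of_dominated_convergence (a := a) (b := a + 2)
    (μ := volume)
    (F := fun (n : ℕ) (u : ℝ) => Real.exp (-((n : ℝ) + 1) ^ 2 * Real.pi ^ 2 * t) *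
      Real.cos (((n : ℝ) + 1) * Real.pi * u)) (f := fun u => Pk t u - 1 / 2)
    (fun n _ => Real.exp (-((n : ℝ) + 1) ^ 2 * Real.pi ^ 2 * t))
    (fun n => Continuous.aestronglyMeasurable (by fun_prop))
    (fun n => Filter.Eventually.of_forall fun u _ => by
      rw [norm_mul, Real.norm_of_nonneg (Real.exp_pos _).le]
      exact mul_le_of_le_one_right (Real.exp_pos _).le (Real.abs_cos_le_one _))
    (Filter.Eventually.of_forall fun u _ => summable_exp_sq ht)
    (by simp) (Filter.Eventually.of_forall fun u _ => Pk_hasSum ht u)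
  have h0 : ∀ n : ℕ, (∫ u in a..(a + 2), Real.exp (-((n : ℝ) + 1) ^ 2 * Real.pi ^ 2 * t) *
      Real.cos (((n : ℝ) + 1) * Real.pi * u)) = 0 := by
    intro n
    have hc : ((n : ℝ) + 1) * Real.pi ≠ 0 := by positivity
    rw [intervalIntegral.integral_const_mul, intervalIntegral.integral_comp_mul_left _ hc,
      integral_cos]
    have : ((n : ℝ) + 1) * Real.pi * (a + 2)
      = ((n : ℝ) + 1) * Real.pi * a + ((n + 1 : ℕ) : ℝ) * (2 * Real.pi) := by push_cast; ring
    rw [this, Real.sin_add_nat_mul_two_pi]; simp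
  simp only [h0] at h
  have h1 := h.unique hasSum_zero
  rw [intervalIntegral.integral_sub ((Pk_continuous ht).intervalIntegrable _ _) (by simp)] at h1
  simp at h1
  linarith

lemma Pk_diff {t t' : ℝ} (ht : 0 < t) (htt : t ≤ t') (a : ℝ) :
    ∫ u in a..(a + 2), |Pk t' u - Pk t u| ≤ 2 * ((t' - t) / t') := by
  have ht' : 0 < t' := ht.trans_le htt
  have c := Pk_continuous ht
  have c' := Pk_continuous ht'
  have hq : t / t' ≤ 1 := (div_le_one ht').2 htt
  have hq' : (t' - t) / t' = 1 - t / t' := by field_simp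
  calc _ ≤ ∫ u in a..(a + 2), (Pk t' u - Pk t u + 2 * ((t' - t) / t') * Pk t u) := by
        apply intervalIntegral.integral_mono_on (by linarith)
          (Continuous.intervalIntegrable (by fun_prop) _ _)
          (Continuous.intervalIntegrable (by fun_prop) _ _)
        intro u _
        have h1 := Pk_mono ht htt u
        have h2 := Pk_nonneg ht u
        rw [hq']
        have h3 : 0 ≤ (1 - t / t') * Pk t u := mul_nonneg (by linarith) h2
        rw [abs_le]; constructor <;> nlinarith
    _ = _ := by
        rw [intervalIntegral.integral_add (Continuous.intervalIntegrable (by fun_prop) _ _)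
          (Continuous.intervalIntegrable (by fun_prop) _ _),
          intervalIntegral.integral_sub (Continuous.intervalIntegrable (by fun_prop) _ _)
          (Continuous.intervalIntegrable (by fun_prop) _ _), intervalIntegral.integral_const_mul,
          Pk_integral ht, Pk_integral ht']
        ring

lemma G_continuous {t : ℝ} (ht : 0 < t) (x : ℝ) : Continuous (G t x) := by
  have : G t x = fun y => Pk t (x - y) - Pk t (x + y) := by ext y; exact G_eq ht x y
  rw [this]
  have c := Pk_continuous ht
  fun_prop

lemma fold (f : ℝ → ℝ) (hf : Continuous f) (x : ℝ) :
    ∫ y in (0 : ℝ)..1, (f (x - y) + f (x + y)) = ∫ u in (x - 1)..(x - 1 + 2), f u := by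
  rw [intervalIntegral.integral_add (Continuous.intervalIntegrable (by fun_prop) _ _)
          (Continuous.intervalIntegrable (by fun_prop) _ _),
    intervalIntegral.integral_comp_sub_left, intervalIntegral.integral_comp_add_left, sub_zero,
    add_zero, intervalIntegral.integral_add_adjacent_intervals
      (Continuous.intervalIntegrable (by fun_prop) _ _)
          (Continuous.intervalIntegrable (by fun_prop) _ _)]
  congr 1; ring

lemma G_l1 {t : ℝ} (ht : 0 < t) (x : ℝ) : ∫ y in Set.Icc (0 : ℝ) 1, |G t x y| ≤ 1 := by
  rw [integral_Icc_eq_integral_Ioc, ← intervalIntegral.integral_of_le zero_le_one]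
  have c := Pk_continuous ht
  have cG := G_continuous ht x
  refine le_trans ?_ (Pk_integral ht (x - 1)).le
  rw [← fold _ c]
  apply intervalIntegral.integral_mono_on (by linarith)
          (Continuous.intervalIntegrable (by fun_prop) _ _)
          (Continuous.intervalIntegrable (by fun_prop) _ _)
  intro y _
  rw [G_eq ht, abs_le]
  have h1 := Pk_nonneg ht (x - y)
  have h2 := Pk_nonneg ht (x + y)
  constructor <;> linarith

lemma G_diff {t t' : ℝ} (ht : 0 < t) (htt : t ≤ t') (x : ℝ) :
    ∫ y in Set.Icc (0 : ℝ) 1, |G t' x y - G t x y| ≤ 2 * ((t' - t) / t') := by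
  have ht' : 0 < t' := ht.trans_le htt
  rw [integral_Icc_eq_integral_Ioc, ← intervalIntegral.integral_of_le zero_le_one]
  have c := Pk_continuous ht
  have c' := Pk_continuous ht'
  have cG := G_continuous ht x
  have cG' := G_continuous ht' x
  refine le_trans ?_ (Pk_diff ht htt (x - 1))
  rw [← fold _ (by fun_prop)]
  apply intervalIntegral.integral_mono_on (by linarith)
          (Continuous.intervalIntegrable (by fun_prop) _ _)
          (Continuous.intervalIntegrable (by fun_prop) _ _)
  intro y _
  rw [G_eq ht, G_eq ht']
  refine le_trans (le_of_eq ?_) (abs_sub _ _)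
  congr 1; ring

lemma G_sup {t : ℝ} (ht : 0 < t) (x y : ℝ) : |G t x y| ≤ t ^ (-(1 / 2) : ℝ) := by
  have hs : ∑' n : ℕ, Real.exp (-((n : ℝ) + 1) ^ 2 * Real.pi ^ 2 * t) ≤
      Real.sqrt (Real.pi / (Real.pi ^ 2 * t)) / 2 := by
    rw [← integral_gaussian_Ioi]
    apply Real.tsum_le_of_sum_range_le (fun n => (Real.exp_pos _).le)
    intro n
    have hb : 0 < Real.pi ^ 2 * t := by positivity
    have h := AntitoneOn.sum_le_integral (x₀ := 0) (a := n)
      (f := fun x : ℝ => Real.exp (-(Real.pi ^ 2 * t) * x ^ 2)) (by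
        intro u hu v hv huv
        apply Real.exp_le_exp.2
        have := hu.1
        have : u ^ 2 ≤ v ^ 2 := by gcongr
        nlinarith)
    refine le_trans (le_of_eq ?_) (h.trans ?_)
    · apply Finset.sum_congr rfl
      intro i _
      congr 1; push_cast; ring
    · rw [intervalIntegral.integral_of_le (by simp)]
      apply setIntegral_mono_set (integrable_exp_neg_mul_sq hb).integrableOn
        (Filter.Eventually.of_forall fun u => (Real.exp_pos _).le)
      exact (Set.Ioc_subset_Ioi_self).eventuallyLE
  have hsum := (summable_exp_sq ht)
  have h2 : |G t x y| ≤ ∑' n : ℕ, 2 * Real.exp (-((n : ℝ) + 1) ^ 2 * Real.pi ^ 2 * t) := by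
    unfold G
    rw [← Real.norm_eq_abs]
    apply tsum_of_norm_bounded (hsum.mul_left 2).hasSum
    intro n
    have hp : ∀ u, |phiF (n + 1) u| ≤ Real.sqrt 2 := by
      intro u
      unfold phiF
      rw [abs_mul, abs_of_nonneg (Real.sqrt_nonneg _)]
      exact mul_le_of_le_one_right (Real.sqrt_nonneg _) (Real.abs_sin_le_one _)
    rw [norm_mul, norm_mul, Real.norm_of_nonneg (Real.exp_pos _).le, Real.norm_eq_abs,
      Real.norm_eq_abs, mul_assoc, mul_comm 2]
    apply mul_le_mul_of_nonneg_left _ (Real.exp_pos _).le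
    have h2 : Real.sqrt 2 * Real.sqrt 2 = 2 := Real.mul_self_sqrt (by norm_num)
    exact (mul_le_mul (hp x) (hp y) (abs_nonneg _) (Real.sqrt_nonneg _)).trans h2.le
  rw [tsum_mul_left] at h2
  refine h2.trans ?_
  rw [Real.rpow_neg ht.le, ← Real.sqrt_eq_rpow, ← Real.sqrt_inv]
  have : Real.sqrt (Real.pi / (Real.pi ^ 2 * t)) ≤ Real.sqrt t⁻¹ := by
    apply Real.sqrt_le_sqrt
    have := Real.pi_gt_three
    rw [inv_eq_one_div, div_le_div_iff₀ (by positivity) ht]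
    nlinarith [mul_pos Real.pi_pos ht]
  linarith

lemma Q_eq (d : ℕ) : Q d = (EuclideanSpace.equiv (Fin d) ℝ) ⁻¹'
    (Set.pi Set.univ fun _ => Set.Icc (0 : ℝ) 1) := by
  ext x
  simp only [Q, Set.mem_ofPred_eq, Set.mem_preimage, Set.mem_pi, Set.mem_univ, forall_true_left]
  rfl

lemma Q_compact (d : ℕ) : IsCompact (Q d) := by
  rw [Q_eq]
  exact (EuclideanSpace.equiv (Fin d) ℝ).toHomeomorph.isCompact_preimage.2
    (isCompact_univ_pi fun _ => isCompact_Icc)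

lemma Q_meas (d : ℕ) : MeasurableSet (Q d) := (Q_compact d).isClosed.measurableSet

lemma Q_prod (d : ℕ) (f : Fin d → ℝ → ℝ) :
    ∫ y in Q d, ∏ i, f i (y i) = ∏ i, ∫ y in Set.Icc (0 : ℝ) 1, f i y := by
  rw [← integral_indicator (Q_meas d)]
  have : ∀ y : EuclideanSpace ℝ (Fin d), (Q d).indicator (fun y => ∏ i, f i (y i)) y
      = ∏ i, (Set.Icc (0 : ℝ) 1).indicator (f i) (y i) := by
    intro y
    by_cases hy : y ∈ Q d
    · rw [Set.indicator_of_mem hy]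
      exact Finset.prod_congr rfl fun i _ => (Set.indicator_of_mem (hy i) _).symm
    · rw [Set.indicator_of_notMem hy]
      have : ∃ i, y i ∉ Set.Icc (0 : ℝ) 1 := by
        by_contra h
        push Not at h
        exact hy h
      obtain ⟨i, hi⟩ := this
      exact (Finset.prod_eq_zero (Finset.mem_univ i) (Set.indicator_of_notMem hi _)).symm
  simp_rw [this]
  have h := (EuclideanSpace.volume_preserving_symm_measurableEquiv_toLp (Fin d)).integral_comp'
    (fun y : Fin d → ℝ => ∏ i, (Set.Icc (0 : ℝ) 1).indicator (f i) (y i))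
  refine Eq.trans h ?_
  rw [integral_fintype_prod_volume_eq_prod]
  exact Finset.prod_congr rfl fun i _ => integral_indicator measurableSet_Icc

lemma tele {ι : Type*} [DecidableEq ι] (s : Finset ι) (a b : ι → ℝ) :
    |∏ i ∈ s, a i - ∏ i ∈ s, b i| ≤
      ∑ i ∈ s, ∏ j ∈ s, (if j = i then |a j - b j| else |a j| + |b j|) := by
  induction s using Finset.induction_on with
  | empty => simp
  | insert k s hk ih =>
    rw [Finset.prod_insert hk, Finset.prod_insert hk, Finset.sum_insert hk, Finset.prod_insert hk,
      if_pos rfl]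
    have e1 : ∏ j ∈ s, (if j = k then |a j - b j| else |a j| + |b j|)
        = ∏ j ∈ s, (|a j| + |b j|) := by
      refine Finset.prod_congr rfl fun j hj => if_neg ?_
      rintro rfl; exact hk hj
    have e2 : ∑ i ∈ s, ∏ j ∈ insert k s, (if j = i then |a j - b j| else |a j| + |b j|)
        = (|a k| + |b k|) * ∑ i ∈ s, ∏ j ∈ s, (if j = i then |a j - b j| else |a j| + |b j|) := by
      rw [Finset.mul_sum]
      refine Finset.sum_congr rfl fun i hi => ?_
      rw [Finset.prod_insert hk, if_neg]
      rintro rfl; exact hk hi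
    rw [e1, e2]
    have e3 : a k * ∏ i ∈ s, a i - b k * ∏ i ∈ s, b i
      = (a k - b k) * ∏ i ∈ s, a i + b k * (∏ i ∈ s, a i - ∏ i ∈ s, b i) := by ring
    rw [e3]
    refine (abs_add_le _ _).trans ?_
    rw [abs_mul, abs_mul]
    apply add_le_add
    · apply mul_le_mul_of_nonneg_left _ (abs_nonneg _)
      rw [Finset.abs_prod]
      exact Finset.prod_le_prod (fun _ _ => abs_nonneg _)
        (fun i _ => le_add_of_nonneg_right (abs_nonneg _))
    · exact mul_le_mul (le_add_of_nonneg_left (abs_nonneg _)) ih (abs_nonneg _) (by positivity)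

lemma Gd_continuous (d : ℕ) {t : ℝ} (ht : 0 < t) (x : EuclideanSpace ℝ (Fin d)) :
    Continuous (Gd d t x) := by
  unfold Gd
  refine continuous_finsetProd _ fun i _ => (G_continuous ht (x i)).comp (by fun_prop)

lemma Gd_sup (d : ℕ) {t : ℝ} (ht : 0 < t) (x y : EuclideanSpace ℝ (Fin d)) :
    |Gd d t x y| ≤ t ^ (-(d / 2) : ℝ) := by
  unfold Gd
  rw [Finset.abs_prod]
  refine (Finset.prod_le_prod (fun _ _ => abs_nonneg _) fun i _ => G_sup ht (x i) (y i)).trans ?_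
  rw [Finset.prod_const, Finset.card_univ, Fintype.card_fin, ← Real.rpow_natCast,
    ← Real.rpow_mul ht.le]
  apply le_of_eq
  congr 1; ring

lemma Gd_diff (d : ℕ) {t t' : ℝ} (ht : 0 < t) (htt : t ≤ t') (x : EuclideanSpace ℝ (Fin d)) :
    ∫ y in Q d, |Gd d t' x y - Gd d t x y| ≤ d * 2 ^ d * ((t' - t) / t') := by
  have ht' : 0 < t' := ht.trans_le htt
  have hq : 0 ≤ (t' - t) / t' := div_nonneg (by linarith) ht'.le
  have cont : ∀ i j : Fin d, Continuous (fun y : ℝ =>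
      if j = i then |G t' (x j) y - G t (x j) y| else |G t' (x j) y| + |G t (x j) y|) := by
    intro i j
    have c := G_continuous ht (x j)
    have c' := G_continuous ht' (x j)
    split_ifs <;> fun_prop
  have cont2 : ∀ i : Fin d, Continuous (fun y : EuclideanSpace ℝ (Fin d) =>
      ∏ j, if j = i then |G t' (x j) (y j) - G t (x j) (y j)|
        else |G t' (x j) (y j)| + |G t (x j) (y j)|) := fun i =>
    continuous_finsetProd _ fun j _ => (cont i j).comp (by fun_prop : Continuous
      fun y : EuclideanSpace ℝ (Fin d) => y j)
  have c := Gd_continuous d ht x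
  have c' := Gd_continuous d ht' x
  calc _ ≤ ∫ y in Q d, ∑ i, ∏ j, (if j = i then |G t' (x j) (y j) - G t (x j) (y j)|
        else |G t' (x j) (y j)| + |G t (x j) (y j)|) := by
        apply setIntegral_mono
        · exact (c'.sub c).abs.continuousOn.integrableOn_compact (Q_compact d)
        · exact (continuous_finsetSum _ fun i _ => cont2 i).continuousOn.integrableOn_compact
            (Q_compact d)
        · intro y
          exact tele Finset.univ (fun i => G t' (x i) (y i)) (fun i => G t (x i) (y i))
    _ = ∑ i, ∏ j, ∫ y in Set.Icc (0 : ℝ) 1, (if j = i then |G t' (x j) y - G t (x j) y|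
        else |G t' (x j) y| + |G t (x j) y|) := by
        rw [integral_finsetSum _ fun i _ =>
          (cont2 i).continuousOn.integrableOn_compact (Q_compact d)]
        refine Finset.sum_congr rfl fun i _ => ?_
        exact Q_prod d (fun j y => if j = i then |G t' (x j) y - G t (x j) y|
          else |G t' (x j) y| + |G t (x j) y|)
    _ ≤ ∑ i : Fin d, ∏ j : Fin d, (2 * if j = i then (t' - t) / t' else 1) := by
        refine Finset.sum_le_sum fun i _ => Finset.prod_le_prod ?_ ?_
        · intro j _
          apply integral_nonneg
          intro y
          dsimp only
          split_ifs <;> positivity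
        · intro j _
          split_ifs
          · exact G_diff ht htt (x j)
          · have c := G_continuous ht (x j)
            have c' := G_continuous ht' (x j)
            rw [integral_add (c'.abs.continuousOn.integrableOn_compact isCompact_Icc)
              (c.abs.continuousOn.integrableOn_compact isCompact_Icc)]
            linarith [G_l1 ht (x j), G_l1 ht' (x j)]
    _ = _ := by
        simp_rw [Finset.prod_mul_distrib]
        simp [mul_assoc]

lemma ball_pot (d : ℕ) (hd : 1 ≤ d) (α : ℝ) (hα : α < d) : ∃ c : ℝ, 0 ≤ c ∧
    ∀ ρ : ℝ, 0 < ρ → ∀ y : EuclideanSpace ℝ (Fin d),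
      Integrable (fun z => (Metric.ball y ρ).indicator (fun z => ‖y - z‖ ^ (-α)) z) ∧
      ∫ z, (Metric.ball y ρ).indicator (fun z => ‖y - z‖ ^ (-α)) z ≤ c * ρ ^ (d - α) := by
  have : Nonempty (Fin d) := ⟨⟨0, hd⟩⟩
  have : Nontrivial (EuclideanSpace ℝ (Fin d)) := inferInstance
  set V := (volume : Measure (EuclideanSpace ℝ (Fin d))).real (Metric.ball 0 1) with hV
  have hV0 : 0 ≤ V := measureReal_nonneg
  refine ⟨d * V * (1 / (d - α)), mul_nonneg (mul_nonneg (by positivity) hV0)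
    (one_div_nonneg.2 (by linarith)), fun ρ hρ y => ?_⟩
  have hfr : Module.finrank ℝ (EuclideanSpace ℝ (Fin d)) = d := by simp
  have key : ∀ z : EuclideanSpace ℝ (Fin d),
      (Metric.ball y ρ).indicator (fun z => ‖y - z‖ ^ (-α)) z
        = (fun w : EuclideanSpace ℝ (Fin d) =>
          (Set.Iio ρ).indicator (fun s : ℝ => s ^ (-α)) ‖w‖) (y - z) := by
    intro z
    simp only [Set.indicator, Metric.mem_ball, Set.mem_Iio, dist_eq_norm, norm_sub_rev z y]
  simp_rw [key]
  have e0 : Set.EqOn (fun s : ℝ => s ^ (d - 1) • (Set.Iio ρ).indicator (fun s : ℝ => s ^ (-α)) s)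
      ((Set.Ioo 0 ρ).indicator fun s : ℝ => s ^ ((d : ℝ) - 1 - α)) (Set.Ioi 0) := by
    intro s hs
    have hs : 0 < s := hs
    by_cases h : s < ρ
    · simp only [Set.indicator, Set.mem_Iio, h, Set.mem_Ioo, hs, and_self, if_true, smul_eq_mul]
      rw [← Real.rpow_natCast, ← Real.rpow_add hs, Nat.cast_sub hd]
      congr 1
      push_cast; ring
    · simp [Set.indicator, h]
  have hI : IntegrableOn (fun s : ℝ => s ^ ((d : ℝ) - 1 - α)) (Set.Ioo 0 ρ) := by
    have := intervalIntegral.intervalIntegrable_rpow' (a := 0) (b := ρ)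
      (show (-1 : ℝ) < (d : ℝ) - 1 - α by linarith)
    rw [intervalIntegrable_iff_integrableOn_Ioo_of_le hρ.le] at this
    exact this
  constructor
  · have : Integrable (fun w : EuclideanSpace ℝ (Fin d) =>
          (Set.Iio ρ).indicator (fun s : ℝ => s ^ (-α)) ‖w‖) := by
      rw [integrable_fun_norm_addHaar volume (f := (Set.Iio ρ).indicator (fun s : ℝ => s ^ (-α))),
        hfr, integrableOn_congr_fun e0 measurableSet_Ioi]
      exact ((integrable_indicator_iff measurableSet_Ioo).2 hI).integrableOn
    exact this.comp_sub_left y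
  · rw [integral_sub_left_eq_self (fun w : EuclideanSpace ℝ (Fin d) =>
          (Set.Iio ρ).indicator (fun s : ℝ => s ^ (-α)) ‖w‖) volume y,
      integral_fun_norm_addHaar volume ((Set.Iio ρ).indicator (fun s : ℝ => s ^ (-α))), hfr,
      setIntegral_congr_fun measurableSet_Ioi e0, setIntegral_indicator measurableSet_Ioo,
      Set.inter_eq_right.2 (fun s hs => hs.1), ← integral_Ioc_eq_integral_Ioo,
      ← intervalIntegral.integral_of_le hρ.le, integral_rpow (Or.inl (by linarith))]
    have e1 : (d : ℝ) - 1 - α + 1 = d - α := by ring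
    rw [e1, Real.zero_rpow (by linarith), nsmul_eq_mul, smul_eq_mul]
    apply le_of_eq
    ring

lemma norm_bound (d : ℕ) (hd : 1 ≤ d) (α : ℝ) (hα0 : 0 < α) (hα : α < d) : ∃ K : ℝ, 0 < K ∧
    ∀ r r' : ℝ, 0 < r → r ≤ r' → ∀ x : EuclideanSpace ℝ (Fin d),
      normAlphaSq d α (fun y => Gd d r' x y - Gd d r x y)
        ≤ K * (r ^ (-(α / 2)) * ((r' - r) / r')) := by
  obtain ⟨c, hc, hball⟩ := ball_pot d hd α hα
  have hd0 : (0 : ℝ) < d := by exact_mod_cast hd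
  set D : ℝ := d * 2 ^ d with hD
  have hD0 : 0 < D := by positivity
  refine ⟨(2 * c + D) * D, by positivity, fun r r' hr hrr x => ?_⟩
  have hr' : 0 < r' := hr.trans_le hrr
  set φ : EuclideanSpace ℝ (Fin d) → ℝ := fun y => Gd d r' x y - Gd d r x y with hφ
  have hφc : Continuous φ := (Gd_continuous d hr' x).sub (Gd_continuous d hr x)
  have hφi : IntegrableOn (fun y => |φ y|) (Q d) :=
    hφc.abs.continuousOn.integrableOn_compact (Q_compact d)
  have hφ1 : ∫ y in Q d, |φ y| ≤ D * ((r' - r) / r') := Gd_diff d hr hrr x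
  have hq : (r' - r) / r' ≤ 1 := (div_le_one hr').2 (by linarith)
  have hq0 : 0 ≤ (r' - r) / r' := div_nonneg (by linarith) hr'.le
  have hφ2 : ∫ y in Q d, |φ y| ≤ D := hφ1.trans (mul_le_of_le_one_right hD0.le hq)
  have hsup : ∀ y, |φ y| ≤ 2 * r ^ (-(d / 2) : ℝ) := by
    intro y
    have h1 := Gd_sup d hr x y
    have h2 := Gd_sup d hr' x y
    have h3 : r' ^ (-(d / 2) : ℝ) ≤ r ^ (-(d / 2) : ℝ) :=
      Real.rpow_le_rpow_of_nonpos hr hrr (by linarith)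
    have h4 := abs_sub (Gd d r' x y) (Gd d r x y)
    simp only [hφ]
    linarith
  set ρ : ℝ := r ^ (1 / 2 : ℝ) with hρdef
  have hρ : 0 < ρ := Real.rpow_pos_of_pos hr _
  have inner : ∀ y, ∫ z in Q d, ‖y - z‖ ^ (-α) * |φ z| ≤ (2 * c + D) * r ^ (-(α / 2)) := by
    intro y
    obtain ⟨hb1, hb2⟩ := hball ρ hρ y
    set b : EuclideanSpace ℝ (Fin d) → ℝ :=
      fun z => (Metric.ball y ρ).indicator (fun z => ‖y - z‖ ^ (-α)) z with hb
    have hb0 : ∀ z, 0 ≤ b z := fun z => Set.indicator_nonneg (fun _ _ => by positivity) z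
    have hM : 0 ≤ 2 * r ^ (-(d / 2) : ℝ) := by positivity
    calc ∫ z in Q d, ‖y - z‖ ^ (-α) * |φ z|
        ≤ ∫ z in Q d, (2 * r ^ (-(d / 2) : ℝ) * b z + ρ ^ (-α) * |φ z|) := by
          apply integral_mono_of_nonneg
          · exact Filter.Eventually.of_forall fun z => by dsimp only [Pi.zero_apply]; positivity
          · exact (hb1.integrableOn.const_mul _).add (hφi.const_mul _)
          · refine Filter.Eventually.of_forall fun z => ?_
            dsimp only
            by_cases hz : z ∈ Metric.ball y ρ
            · have : b z = ‖y - z‖ ^ (-α) := Set.indicator_of_mem hz _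
              rw [this]
              have h1 : ‖y - z‖ ^ (-α) * |φ z| ≤ ‖y - z‖ ^ (-α) * (2 * r ^ (-(d / 2) : ℝ)) :=
                mul_le_mul_of_nonneg_left (hsup z) (by positivity)
              have h2 : 0 ≤ ρ ^ (-α) * |φ z| := by positivity
              linarith
            · have h1 : ρ ≤ ‖y - z‖ := by
                rw [Metric.mem_ball, not_lt, dist_eq_norm, norm_sub_rev] at hz
                exact hz
              have h2 : ‖y - z‖ ^ (-α) * |φ z| ≤ ρ ^ (-α) * |φ z| :=
                mul_le_mul_of_nonneg_right
                  (Real.rpow_le_rpow_of_nonpos hρ h1 (by linarith)) (abs_nonneg _)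
              have := mul_nonneg hM (hb0 z)
              linarith
      _ = 2 * r ^ (-(d / 2) : ℝ) * (∫ z in Q d, b z) + ρ ^ (-α) * ∫ z in Q d, |φ z| := by
          rw [integral_add (hb1.integrableOn.const_mul _) (hφi.const_mul _),
            integral_const_mul, integral_const_mul]
      _ ≤ 2 * r ^ (-(d / 2) : ℝ) * (c * ρ ^ (d - α)) + ρ ^ (-α) * D := by
          gcongr
          exact (setIntegral_le_integral hb1 (Filter.Eventually.of_forall hb0)).trans hb2
      _ = (2 * c + D) * r ^ (-(α / 2)) := by
          rw [hρdef, ← Real.rpow_mul hr.le, ← Real.rpow_mul hr.le]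
          have e1 : r ^ (1 / 2 * ((d : ℝ) - α)) = r ^ ((d : ℝ) / 2) * r ^ (-(α / 2)) := by
            rw [← Real.rpow_add hr]; congr 1; ring
          have e2 : r ^ (-(d / 2) : ℝ) * r ^ ((d : ℝ) / 2) = 1 := by
            rw [← Real.rpow_add hr]; simp
          have e3 : (1 / 2 : ℝ) * (-α) = -(α / 2) := by ring
          rw [e1, e3]
          linear_combination (2 * c * r ^ (-(α / 2))) * e2
  calc normAlphaSq d α φ = ∫ y in Q d, |φ y| * ∫ z in Q d, ‖y - z‖ ^ (-α) * |φ z| := by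
        unfold normAlphaSq
        congr 1
        ext y
        rw [← integral_const_mul]
        simp_rw [mul_assoc]
    _ ≤ ∫ y in Q d, |φ y| * ((2 * c + D) * r ^ (-(α / 2))) := by
        apply integral_mono_of_nonneg
        · refine Filter.Eventually.of_forall fun y => mul_nonneg (abs_nonneg _)
            (integral_nonneg fun z => ?_)
          dsimp only [Pi.zero_apply]; positivity
        · exact hφi.mul_const _
        · exact Filter.Eventually.of_forall fun y =>
            mul_le_mul_of_nonneg_left (inner y) (abs_nonneg _)
    _ = (∫ y in Q d, |φ y|) * ((2 * c + D) * r ^ (-(α / 2))) := integral_mul_const _ _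
    _ ≤ D * ((r' - r) / r') * ((2 * c + D) * r ^ (-(α / 2))) := by gcongr
    _ = _ := by ring

lemma normAlphaSq_nonneg (d : ℕ) (α : ℝ) (f : EuclideanSpace ℝ (Fin d) → ℝ) :
    0 ≤ normAlphaSq d α f :=
  integral_nonneg fun y => integral_nonneg fun z => by dsimp only [Pi.zero_apply]; positivity

lemma time_bound (α : ℝ) (h0 : 0 < α) (h2 : α < 2) (h : ℝ) (hh : 0 < h) :
    ∃ g : ℝ → ℝ, IntegrableOn g (Set.Ioi 0) ∧
      (∀ r, 0 < r → r ^ (-(α / 2)) * (h / (r + h)) ≤ g r) ∧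
      (∫ r in Set.Ioi 0, g r) ≤ (1 / (1 - α / 2) + 1 / (α / 2)) * h ^ (1 - α / 2) := by
  set g : ℝ → ℝ := fun r => if r ≤ h then r ^ (-(α / 2)) else h * r ^ (-1 - α / 2) with hg
  have e1 : Set.EqOn g (fun r => r ^ (-(α / 2))) (Set.Ioc 0 h) := fun r hr => if_pos hr.2
  have e2 : Set.EqOn g (fun r => h * r ^ (-1 - α / 2)) (Set.Ioi h) :=
    fun r hr => if_neg (not_le.2 hr)
  have i1 : IntegrableOn g (Set.Ioc 0 h) := by
    rw [integrableOn_congr_fun e1 measurableSet_Ioc]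
    have := intervalIntegral.intervalIntegrable_rpow' (a := 0) (b := h)
      (show (-1 : ℝ) < -(α / 2) by linarith)
    rwa [intervalIntegrable_iff_integrableOn_Ioc_of_le hh.le] at this
  have i2 : IntegrableOn g (Set.Ioi h) := by
    rw [integrableOn_congr_fun e2 measurableSet_Ioi]
    exact (integrableOn_Ioi_rpow_of_lt (by linarith) hh).const_mul _
  refine ⟨g, ?_, ?_, ?_⟩
  · rw [← Set.Ioc_union_Ioi_eq_Ioi hh.le]
    exact i1.union i2
  · intro r hr
    simp only [hg]
    split_ifs with hrh
    · exact mul_le_of_le_one_right (by positivity) ((div_le_one (by positivity)).2 (by linarith))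
    · have : r ^ (-1 - α / 2) = r ^ (-(α / 2)) * r⁻¹ := by
        rw [← Real.rpow_neg_one, ← Real.rpow_add hr]; congr 1; ring
      rw [this]
      have h3 : h / (r + h) ≤ h * r⁻¹ := by
        rw [← div_eq_mul_inv]; gcongr; linarith
      calc _ ≤ r ^ (-(α / 2)) * (h * r⁻¹) := by gcongr
        _ = _ := by ring
  · rw [← Set.Ioc_union_Ioi_eq_Ioi hh.le,
      setIntegral_union (Set.Ioc_disjoint_Ioi le_rfl) measurableSet_Ioi i1 i2,
      setIntegral_congr_fun measurableSet_Ioc e1, setIntegral_congr_fun measurableSet_Ioi e2,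
      integral_const_mul, integral_Ioi_rpow_of_lt (by linarith) hh,
      ← intervalIntegral.integral_of_le hh.le, integral_rpow (Or.inl (by linarith))]
    have e3 : -(α / 2) + 1 = 1 - α / 2 := by ring
    have e4 : -1 - α / 2 + 1 = -(α / 2) := by ring
    have e5 : h ^ (1 - α / 2) = h * h ^ (-(α / 2)) := by
      rw [sub_eq_add_neg, Real.rpow_add hh, Real.rpow_one]
    rw [e3, e4, Real.zero_rpow (by linarith)]
    apply le_of_eq
    rw [add_mul, e5]
    have : 1 - α / 2 ≠ 0 := by linarith
    field_simp
    ring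

/-- time increments of the Green function in the `‖·‖_{(α)}` norm. -/
theorem stmt_5 (d : ℕ) (hd : 1 ≤ d) (α : ℝ) (hα : α ∈ Set.Ioo (0 : ℝ) (min 2 (d : ℝ))) :
    ∃ C : ℝ, 0 < C ∧ ∀ t t' : ℝ, 0 < t → t ≤ t' → ∀ x ∈ Q d,
      (∫ s in (0 : ℝ)..t, normAlphaSq d α (fun y => Gd d (t' - s) x y - Gd d (t - s) x y))
        ≤ C * (t' - t) ^ (1 - α / 2) := by
  obtain ⟨hα0, hα1⟩ := hα
  have hα2 : α < 2 := hα1.trans_le (min_le_left _ _)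
  have hαd : α < d := hα1.trans_le (min_le_right _ _)
  obtain ⟨K, hK, hbound⟩ := norm_bound d hd α hα0 hαd
  have hA : 0 < 1 - α / 2 := by linarith
  refine ⟨K * (1 / (1 - α / 2) + 1 / (α / 2)), by positivity, fun t t' ht htt x _ => ?_⟩
  rcases htt.eq_or_lt with rfl | hlt
  · have : (1 - α / 2) ≠ 0 := hA.ne'
    simp [normAlphaSq, Real.zero_rpow this]
  have hh : 0 < t' - t := sub_pos.2 hlt
  obtain ⟨g, hgi, hgb, hgI⟩ := time_bound α hα0 hα2 (t' - t) hh
  have hg0 : ∀ r, 0 < r → 0 ≤ g r := fun r hr => le_trans (by positivity) (hgb r hr)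
  have hgt : IntervalIntegrable g volume 0 t := by
    rw [intervalIntegrable_iff_integrableOn_Ioc_of_le ht.le]
    exact hgi.mono_set Set.Ioc_subset_Ioi_self
  have hgt' : IntervalIntegrable (fun s => g (t - s)) volume 0 t := by
    have := hgt.comp_sub_left t
    simpa using this.symm
  calc (∫ s in (0 : ℝ)..t, normAlphaSq d α (fun y => Gd d (t' - s) x y - Gd d (t - s) x y))
      ≤ ∫ s in (0 : ℝ)..t, K * g (t - s) := by
        rw [intervalIntegral.integral_of_le ht.le, intervalIntegral.integral_of_le ht.le,
          integral_Ioc_eq_integral_Ioo, integral_Ioc_eq_integral_Ioo]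
        apply integral_mono_of_nonneg
        · exact Filter.Eventually.of_forall fun s => normAlphaSq_nonneg _ _ _
        · exact ((intervalIntegrable_iff_integrableOn_Ioo_of_le ht.le).1 hgt').const_mul K
        · filter_upwards [ae_restrict_mem measurableSet_Ioo] with s hs
          have hr : 0 < t - s := sub_pos.2 hs.2
          refine (hbound (t - s) (t' - s) hr (by linarith) x).trans ?_
          have h1 := hgb (t - s) hr
          have e1 : t' - s - (t - s) = t' - t := by ring
          have e2 : t - s + (t' - t) = t' - s := by ring
          rw [e2] at h1
          rw [e1]
          gcongr
    _ = K * ∫ r in (0 : ℝ)..t, g r := by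
        rw [intervalIntegral.integral_const_mul, intervalIntegral.integral_comp_sub_left]
        simp
    _ ≤ K * ∫ r in Set.Ioi 0, g r := by
        gcongr
        rw [intervalIntegral.integral_of_le ht.le]
        apply setIntegral_mono_set hgi
        · filter_upwards [ae_restrict_mem measurableSet_Ioi] with r hr using hg0 r hr
        · exact (Set.Ioc_subset_Ioi_self).eventuallyLE
    _ ≤ K * ((1 / (1 - α / 2) + 1 / (α / 2)) * (t' - t) ^ (1 - α / 2)) := by gcongr
    _ = _ := by ring
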